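/- arXiv:1909.04858 — 2 statements merged into one kernel-verified Lean document; each statement's English description precedes it below -/
import Mathlib

section
/- Regularity lemma for multidimensional matrices: For every integer d ≥ 1 and every real ε with 0 < ε < 1/2 there exist natural numbers N and T such that for every finite alphabet Σ and every d-dimensional matrix A of order n ≥ N over Σ there exists an ε-regular balanced block partition 𝓑 of A whose cardinality |𝓑| is at most T. -/
/-
STATEMENT 0: Regularity lemma for multidimensional matrices: for every d ≥ 1 and every
0 < ε < 1/2 there exist N, T ∈ ℕ such that every d-dimensional matrix of order n ≥ N
over a finite alphabet has an ε-regular balanced block partition 𝓑 with |𝓑| ≤ T.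
-/

open Finset

noncomputable section

/-- The weight `w_σ(B)` of the symbol `σ` in the block of `A` indexed by `S_1 × … × S_d`. -/
def blockWeight {d n : ℕ} {T : Type*} [DecidableEq T]
    (A : (Fin d → Fin n) → T) (S : Fin d → Finset (Fin n)) (σ : T) : ℕ :=
  (Finset.univ.filter fun α : Fin d → Fin n => (∀ i, α i ∈ S i) ∧ A α = σ).card

/-- The volume (number of entries) of the block indexed by `S_1 × … × S_d`. -/
def blockVol {d n : ℕ} (S : Fin d → Finset (Fin n)) : ℕ := ∏ i, (S i).card

/-- The density `ρ_σ(B)` of the symbol `σ` in the block of `A` indexed by `S_1 × … × S_d`. -/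
def blockDensity {d n : ℕ} {T : Type*} [DecidableEq T]
    (A : (Fin d → Fin n) → T) (S : Fin d → Finset (Fin n)) (σ : T) : ℝ :=
  (blockWeight A S σ : ℝ) / (blockVol S : ℝ)

/-- The block of `A` indexed by `S_1 × … × S_d` is `ε`-regular if for every symbol `σ`
and every sub-block `U_1 × … × U_d` with `U_i ⊆ S_i` and `|U_i| ≥ ε·|S_i|` for all `i`,
`|ρ_σ(U) − ρ_σ(S)| ≤ ε`.  Applied with `S i = univ`, this says that the matrix `A`
itself is `ε`-regular. -/
def IsRegularBlock {d n : ℕ} {T : Type*} [DecidableEq T] (ε : ℝ)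
    (A : (Fin d → Fin n) → T) (S : Fin d → Finset (Fin n)) : Prop :=
  ∀ (σ : T) (U : Fin d → Finset (Fin n)), (∀ i, U i ⊆ S i) →
    (∀ i, ε * ((S i).card : ℝ) ≤ ((U i).card : ℝ)) →
    |blockDensity A U σ - blockDensity A S σ| ≤ ε

/-- A balanced block partition of a `d`-dimensional matrix of order `n`: for each
direction `i`, the index set `Fin n` is partitioned into `t` ordinary parts (labelled by
`Fin t`, each of the same size `m`) and `e i` exceptional parts (labelled by `Fin (e i)`,
of arbitrary sizes); the labelling is encoded by the map `p i`.  The blocks of the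
partition are the products of one part per direction; a block is ordinary iff all its
parts are ordinary. -/
structure BalancedPartition (d n : ℕ) where
  /-- number of ordinary parts in each direction -/
  t : ℕ
  /-- common size of the ordinary parts -/
  m : ℕ
  /-- number of exceptional parts in each direction -/
  e : Fin d → ℕ
  /-- the labelling maps: `Sum.inl j` is the `j`-th ordinary part, `Sum.inr k` the
  `k`-th exceptional part -/
  p : ∀ i : Fin d, Fin n → Fin t ⊕ Fin (e i)
  balanced : ∀ (i : Fin d) (j : Fin t),
    (Finset.univ.filter fun x : Fin n => p i x = Sum.inl j).card = m

namespace BalancedPartition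

variable {d n : ℕ} (P : BalancedPartition d n)

/-- The part of direction `i` labelled `c`. -/
def part (i : Fin d) (c : Fin P.t ⊕ Fin (P.e i)) : Finset (Fin n) :=
  Finset.univ.filter fun x => P.p i x = c

/-- The block indexed by `β` (one part label per direction). -/
def blockSets (β : ∀ i, Fin P.t ⊕ Fin (P.e i)) : Fin d → Finset (Fin n) :=
  fun i => P.part i (β i)

/-- The ordinary block indexed by `γ : Fin d → Fin P.t`. -/
def ordBlockSets (γ : Fin d → Fin P.t) : Fin d → Finset (Fin n) :=
  fun i => P.part i (Sum.inl (γ i))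

/-- The sum of the volumes of all exceptional blocks of the partition. -/
def exceptVol : ℕ :=
  ∑ β ∈ Finset.univ.filter (fun β : ∀ i, Fin P.t ⊕ Fin (P.e i) => ∃ i, (β i).isRight),
    ∏ i, (P.part i (β i)).card

/-- A balanced block partition is `ε`-regular (w.r.t. the matrix `A`) if the sum of the
volumes of its exceptional blocks is at most `ε·|A| = ε·n^d` and all but at most
`ε·|𝓑| = ε·t^d` of its `t^d` ordinary blocks are `ε`-regular. -/
def IsRegularPartition (ε : ℝ) {T : Type*} [DecidableEq T]
    (A : (Fin d → Fin n) → T) : Prop :=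
  (P.exceptVol : ℝ) ≤ ε * (n : ℝ) ^ d ∧
  ({γ : Fin d → Fin P.t | ¬ IsRegularBlock ε A (P.ordBlockSets γ)}.ncard : ℝ) ≤
    ε * (P.t : ℝ) ^ d

end BalancedPartition

section Helpers

variable {X L L' : Type*} [Fintype X] [DecidableEq X] [DecidableEq L] [DecidableEq L']

/-- average of `g` over the fibre of `φ` through `x`. -/
def cavg (φ : X → L) (g : X → ℝ) (x : X) : ℝ :=
  (∑ y ∈ univ.filter (fun y => φ y = φ x), g y) / ((univ.filter (fun y => φ y = φ x)).card : ℝ)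

/-- energy -/
def en (φ : X → L) (g : X → ℝ) : ℝ := ∑ x, cavg φ g x ^ 2

lemma cavg_congr (φ : X → L) (g : X → ℝ) {x y : X} (h : φ x = φ y) :
    cavg φ g x = cavg φ g y := by
  unfold cavg; rw [h]

lemma cavg_key (φ : X → L) (g k : X → ℝ) (hk : ∀ x y, φ x = φ y → k x = k y) :
    ∑ x, cavg φ g x * k x = ∑ x, g x * k x := by
  have h1 : ∀ x, cavg φ g x * k x = ∑ y, if φ y = φ x then
      g y * k y / ((univ.filter (fun z => φ z = φ y)).card : ℝ) else 0 := by
    intro x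
    unfold cavg
    rw [← Finset.sum_filter, Finset.sum_div, Finset.sum_mul]
    refine Finset.sum_congr rfl fun y hy => ?_
    have hy' : φ y = φ x := by simpa using hy
    rw [hk x y hy'.symm, hy']
    ring
  simp_rw [h1]
  rw [Finset.sum_comm]
  refine Finset.sum_congr rfl fun y _ => ?_
  rw [← Finset.sum_filter, Finset.sum_const, nsmul_eq_mul]
  have h2 : (univ.filter (fun x => φ y = φ x)) = univ.filter (fun z => φ z = φ y) := by
    ext z; simp [eq_comm]
  rw [h2]
  have h3 : ((univ.filter (fun z => φ z = φ y)).card : ℝ) ≠ 0 := by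
    have : 0 < (univ.filter (fun z => φ z = φ y)).card := Finset.card_pos.2 ⟨y, by simp⟩
    positivity
  field_simp

lemma en_le (φ : X → L) (g : X → ℝ) : en φ g ≤ ∑ x, g x ^ 2 := by
  have h := cavg_key φ g (cavg φ g) (fun x y h => cavg_congr φ g h)
  have h2 : 0 ≤ ∑ x, (g x - cavg φ g x) ^ 2 := Finset.sum_nonneg fun _ _ => sq_nonneg _
  have h3 : ∑ x, (g x - cavg φ g x) ^ 2 =
      ∑ x, g x ^ 2 - 2 * ∑ x, g x * cavg φ g x + ∑ x, cavg φ g x * cavg φ g x := by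
    rw [Finset.mul_sum, ← Finset.sum_sub_distrib, ← Finset.sum_add_distrib]
    exact Finset.sum_congr rfl fun _ _ => by ring
  have h4 : en φ g = ∑ x, cavg φ g x * cavg φ g x :=
    Finset.sum_congr rfl fun _ _ => by ring
  linarith

lemma en_pyth (φ : X → L) (ψ : X → L') (hr : ∀ x y, ψ x = ψ y → φ x = φ y) (g : X → ℝ) :
    en ψ g = en φ g + ∑ x, (cavg ψ g x - cavg φ g x) ^ 2 := by
  have h := cavg_key φ g (cavg φ g) (fun x y h => cavg_congr φ g h)
  have h' := cavg_key ψ g (cavg φ g) (fun x y h => cavg_congr φ g (hr x y h))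
  have h3 : ∑ x, (cavg ψ g x - cavg φ g x) ^ 2 =
      en ψ g - 2 * ∑ x, cavg ψ g x * cavg φ g x + ∑ x, cavg φ g x * cavg φ g x := by
    unfold en
    rw [Finset.mul_sum, ← Finset.sum_sub_distrib, ← Finset.sum_add_distrib]
    exact Finset.sum_congr rfl fun _ _ => by ring
  have h4 : en φ g = ∑ x, cavg φ g x * cavg φ g x :=
    Finset.sum_congr rfl fun _ _ => by ring
  linarith

lemma en_mono (φ : X → L) (ψ : X → L') (hr : ∀ x y, ψ x = ψ y → φ x = φ y) (g : X → ℝ) :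
    en φ g ≤ en ψ g := by
  rw [en_pyth φ ψ hr g]
  have : 0 ≤ ∑ x, (cavg ψ g x - cavg φ g x) ^ 2 := Finset.sum_nonneg fun _ _ => sq_nonneg _
  linarith

lemma defect (φ : X → L) (ψ : X → L') (g : X → ℝ) (U : Finset X)
    (hU : ∀ x y, ψ x = ψ y → (x ∈ U ↔ y ∈ U)) (ρ ρU : ℝ) (hρ : ∀ x ∈ U, cavg φ g x = ρ)
    (hρU : ∑ x ∈ U, g x = ρU * U.card) (hpos : 0 < U.card) :
    (U.card : ℝ) * (ρU - ρ) ^ 2 ≤ ∑ x ∈ U, (cavg ψ g x - cavg φ g x) ^ 2 := by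
  have h := cavg_key ψ g (fun x => if x ∈ U then 1 else 0) (fun x y h => by simp [hU x y h])
  simp only [mul_ite, mul_one, mul_zero, Finset.sum_ite_mem, Finset.univ_inter] at h
  have h1 : ∑ x ∈ U, (cavg ψ g x - cavg φ g x) = U.card * (ρU - ρ) := by
    rw [Finset.sum_sub_distrib, h, hρU, Finset.sum_congr rfl hρ, Finset.sum_const, nsmul_eq_mul]
    ring
  have h2 := sq_sum_le_card_mul_sum_sq (s := U) (f := fun x => cavg ψ g x - cavg φ g x)
  rw [h1] at h2
  have h3 : (0 : ℝ) < U.card := by exact_mod_cast hpos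
  refine le_of_mul_le_mul_left ?_ h3
  calc _ = ((U.card : ℝ) * (ρU - ρ)) ^ 2 := by ring
    _ ≤ _ := h2

end Helpers

/-- chunking a labelled set -/
lemma chunk {n k : ℕ} (f : Fin n → Fin k) (m : ℕ) (hm : 1 ≤ m) :
    ∀ t : ℕ, t * m + k * m ≤ n → ∃ p : Fin n → Fin t ⊕ Fin k,
      (∀ j, (univ.filter fun x => p x = Sum.inl j).card = m) ∧
      (∀ x c, p x = Sum.inr c → f x = c) ∧ (∀ x y, p x = p y → f x = f y) := by
  intro t
  induction t with
  | zero =>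
    intro _
    refine ⟨fun x => Sum.inr (f x), fun j => j.elim0, ?_, ?_⟩
    · intro x c h; exact Sum.inr.inj h
    · intro x y h; exact Sum.inr.inj h
  | succ t ih =>
    intro hn
    have hn' : t * m + m + k * m ≤ n := by rw [Nat.succ_mul] at hn; exact hn
    obtain ⟨p, hp, hp2, hp3⟩ := ih (by omega)
    have hsum : n = ∑ c : Fin t ⊕ Fin k, (univ.filter fun x => p x = c).card := by
      have := Finset.card_eq_sum_card_fiberwise (f := p) (s := univ) (t := univ)
        (fun _ _ => by simp)
      simpa using this
    rw [Fintype.sum_sum_type] at hsum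
    simp only [hp, Finset.sum_const, Finset.card_univ, Fintype.card_fin, smul_eq_mul] at hsum
    have hex : ∃ c : Fin k, m ≤ (univ.filter fun x => p x = Sum.inr c).card := by
      by_contra hcon
      push Not at hcon
      have : ∑ c : Fin k, (univ.filter fun x => p x = Sum.inr c).card ≤ ∑ c : Fin k, m :=
        Finset.sum_le_sum fun c _ => (hcon c).le
      simp at this
      omega
    obtain ⟨c, hc⟩ := hex
    obtain ⟨S, hS, hSc⟩ := Finset.exists_subset_card_eq hc
    have hS' : ∀ x ∈ S, p x = Sum.inr c := fun x hx => by simpa using hS hx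
    refine ⟨fun x => if x ∈ S then Sum.inl (Fin.last t) else Sum.map Fin.castSucc id (p x),
      ?_, ?_, ?_⟩
    · intro j
      refine Fin.lastCases ?_ (fun j => ?_) j
      · rw [← hSc]
        congr 1
        ext x
        simp only [Finset.mem_filter, Finset.mem_univ, true_and]
        by_cases hx : x ∈ S
        · simp [hx]
        · simp only [hx, if_false, iff_false]
          rcases p x with a | a
          · simpa using (Fin.castSucc_lt_last a).ne
          · simp
      · rw [← hp j]
        congr 1
        ext x
        simp only [Finset.mem_filter, Finset.mem_univ, true_and]
        by_cases hx : x ∈ S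
        · simp only [hx, if_true, hS' x hx]
          simpa using (Fin.castSucc_lt_last j).ne'
        · simp only [hx, if_false]
          rcases p x with a | a <;> simp
    · intro x c' h
      by_cases hx : x ∈ S
      · simp [hx] at h
      · simp only [hx, if_false] at h
        apply hp2
        rcases hpx : p x with a | a
        · simp [hpx] at h
        · simpa [hpx] using h
    · intro x y h
      have aux : ∀ z, z ∉ S → Sum.map Fin.castSucc id (p z) ≠
          (Sum.inl (Fin.last t) : Fin (t+1) ⊕ Fin k) := by
        intro z _ h
        rcases hpz : p z with a | a
        · rw [hpz] at h; simp at h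
        · rw [hpz] at h; simp at h
      by_cases hx : x ∈ S <;> by_cases hy : y ∈ S
      · rw [hp2 x c (hS' x hx), hp2 y c (hS' y hy)]
      · simp only [hx, hy, if_true, if_false] at h
        exact absurd h.symm (aux y hy)
      · simp only [hx, hy, if_true, if_false] at h
        exact absurd h (aux x hx)
      · simp only [hx, hy, if_false] at h
        exact hp3 x y (Sum.map_injective.2 ⟨Fin.castSucc_injective t, Function.injective_id⟩ h)

/-- product labelling -/
def plab {d n : ℕ} {L : Fin d → Type*} (f : ∀ i, Fin n → L i) (α : Fin d → Fin n) :
    ∀ i, L i := fun i => f i (α i)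

/-- indicator of symbol -/
def ind {X T : Type*} [DecidableEq T] (A : X → T) (σ : T) (x : X) : ℝ := if A x = σ then 1 else 0

/-- total energy -/
def toten {d n : ℕ} {T : Type*} [Fintype T] [DecidableEq T] {L : Fin d → Type*}
    [∀ i, DecidableEq (L i)]
    (A : (Fin d → Fin n) → T) (f : ∀ i, Fin n → L i) : ℝ := ∑ σ, en (plab f) (ind A σ)

lemma toten_le {d n : ℕ} {T : Type*} [Fintype T] [DecidableEq T] {L : Fin d → Type*}
    [∀ i, DecidableEq (L i)]
    (A : (Fin d → Fin n) → T) (f : ∀ i, Fin n → L i) : toten A f ≤ (n : ℝ) ^ d := by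
  calc toten A f ≤ ∑ σ, ∑ x, ind A σ x ^ 2 := Finset.sum_le_sum fun σ _ => en_le _ _
    _ = ∑ x : Fin d → Fin n, (1 : ℝ) := by
        rw [Finset.sum_comm]
        refine Finset.sum_congr rfl fun x _ => ?_
        simp [ind]
    _ = _ := by simp

lemma toten_nonneg {d n : ℕ} {T : Type*} [Fintype T] [DecidableEq T] {L : Fin d → Type*}
    [∀ i, DecidableEq (L i)]
    (A : (Fin d → Fin n) → T) (f : ∀ i, Fin n → L i) : 0 ≤ toten A f :=
  Finset.sum_nonneg fun _ _ => Finset.sum_nonneg fun _ _ => sq_nonneg _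

lemma toten_mono {d n : ℕ} {T : Type*} [Fintype T] [DecidableEq T] {L L' : Fin d → Type*}
    [∀ i, DecidableEq (L i)] [∀ i, DecidableEq (L' i)]
    (A : (Fin d → Fin n) → T) (f : ∀ i, Fin n → L i) (f' : ∀ i, Fin n → L' i)
    (h : ∀ i x y, f' i x = f' i y → f i x = f i y) : toten A f ≤ toten A f' :=
  Finset.sum_le_sum fun _ _ => en_mono _ _
    (fun x y hxy => funext fun i => h i _ _ (congrFun hxy i)) _

/-- block as finset -/
def blk {d n : ℕ} (S : Fin d → Finset (Fin n)) : Finset (Fin d → Fin n) :=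
  univ.filter fun α => ∀ i, α i ∈ S i

lemma blk_card {d n : ℕ} (S : Fin d → Finset (Fin n)) : (blk S).card = blockVol S := by
  have : blk S = Fintype.piFinset S := by ext; simp [blk]
  rw [this, Fintype.card_piFinset]; rfl

lemma blk_sum {d n : ℕ} {T : Type*} [DecidableEq T]
    (A : (Fin d → Fin n) → T) (S : Fin d → Finset (Fin n)) (σ : T) :
    ∑ x ∈ blk S, ind A σ x = blockWeight A S σ := by
  unfold ind blk blockWeight
  rw [Finset.sum_boole, Finset.filter_filter]

set_option maxHeartbeats 1600000 in
lemma increment {d n k t : ℕ} {T : Type*} [Fintype T] [DecidableEq T] (ε : ℝ) (hε : 0 < ε)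
    (A : (Fin d → Fin n) → T) (P : BalancedPartition d n) (hm : 1 ≤ P.m)
    (ht : P.t = t) (he : ∀ i, P.e i = k)
    (hex : (1 / 2) * (n : ℝ) ^ d ≤ ((P.t : ℝ) * P.m) ^ d)
    (hirr : ε * (P.t : ℝ) ^ d <
      ({γ : Fin d → Fin P.t | ¬ IsRegularBlock ε A (P.ordBlockSets γ)}.ncard : ℝ)) :
    ∃ f : Fin d → Fin n → Fin ((t + k) * 2 ^ (t ^ d)),
      toten A P.p + (ε ^ (d + 3) / 2) * (n : ℝ) ^ d ≤ toten A f := by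
  classical
  subst ht
  have hw : ∀ γ : Fin d → Fin P.t, ∃ (σU : Option T × (Fin d → Finset (Fin n))),
      ¬ IsRegularBlock ε A (P.ordBlockSets γ) → ∃ σ, σU.1 = some σ ∧
        (∀ i, σU.2 i ⊆ P.ordBlockSets γ i) ∧
        (∀ i, ε * ((P.ordBlockSets γ i).card : ℝ) ≤ ((σU.2 i).card : ℝ)) ∧
        ε < |blockDensity A σU.2 σ - blockDensity A (P.ordBlockSets γ) σ| := by
    intro γ
    by_cases h : IsRegularBlock ε A (P.ordBlockSets γ)
    · exact ⟨(none, fun _ => ∅), fun h' => absurd h h'⟩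
    · have h0 := h
      unfold IsRegularBlock at h
      push Not at h
      obtain ⟨σ, U, h1, h2, h3⟩ := h
      exact ⟨(some σ, U), fun _ => ⟨σ, rfl, h1, h2, h3⟩⟩
  choose W hW using hw
  let q : ∀ i : Fin d, Fin n → (Fin P.t ⊕ Fin (P.e i)) × ((Fin d → Fin P.t) → Bool) :=
    fun i x => (P.p i x, fun γ => decide (x ∈ (W γ).2 i))
  have hcard : ∀ i : Fin d, Fintype.card ((Fin P.t ⊕ Fin (P.e i)) × ((Fin d → Fin P.t) → Bool))
      = (P.t + k) * 2 ^ (P.t ^ d) := by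
    intro i; simp [he i]
  let f : Fin d → Fin n → Fin ((P.t + k) * 2 ^ (P.t ^ d)) :=
    fun i x => Fintype.equivFinOfCardEq (hcard i) (q i x)
  have hfq : ∀ i x y, f i x = f i y → q i x = q i y := fun i x y h =>
    (Fintype.equivFinOfCardEq (hcard i)).injective h
  refine ⟨f, ?_⟩
  have hfp : ∀ i x y, f i x = f i y → P.p i x = P.p i y := fun i x y h =>
    congrArg Prod.fst (hfq i x y h)
  have hfW : ∀ i x y, f i x = f i y → ∀ γ, (x ∈ (W γ).2 i ↔ y ∈ (W γ).2 i) := by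
    intro i x y h γ
    have := congrFun (congrArg Prod.snd (hfq i x y h)) γ
    simpa [q] using this
  have hpy : toten A f = toten A P.p + ∑ σ, ∑ x,
      (cavg (plab f) (ind A σ) x - cavg (plab P.p) (ind A σ) x) ^ 2 := by
    unfold toten
    rw [← Finset.sum_add_distrib]
    exact Finset.sum_congr rfl fun σ _ => en_pyth _ _
      (fun x y hxy => funext fun i => hfp i _ _ (congrFun hxy i)) _
  rw [hpy]
  gcongr
  rw [Finset.sum_comm]
  set F : (Fin d → Fin n) → ℝ := fun x => ∑ σ,
      (cavg (plab f) (ind A σ) x - cavg (plab P.p) (ind A σ) x) ^ 2 with hF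
  have hF0 : ∀ x, 0 ≤ F x := fun x => Finset.sum_nonneg fun _ _ => sq_nonneg _
  set I : Finset (Fin d → Fin P.t) :=
    univ.filter fun γ => ¬ IsRegularBlock ε A (P.ordBlockSets γ) with hI
  have hIc : ({γ : Fin d → Fin P.t | ¬ IsRegularBlock ε A (P.ordBlockSets γ)}.ncard : ℝ)
      = I.card := by
    rw [← Set.ncard_coe_finset I]
    congr 2
    ext; simp [hI]
  have hpart : ∀ (γ : Fin d → Fin P.t) i, (P.ordBlockSets γ i).card = P.m := fun γ i =>
    P.balanced i (γ i)
  have hblk : ∀ γ ∈ I, ε ^ (d + 2) * (P.m : ℝ) ^ d ≤ ∑ x ∈ blk (P.ordBlockSets γ), F x := by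
    intro γ hγ
    obtain ⟨σ, -, hs, hc, hd⟩ := hW γ (by simpa [hI] using hγ)
    set U := (W γ).2 with hU
    have hmpos : (0 : ℝ) < P.m := by exact_mod_cast hm
    have hvol : ε ^ d * (P.m : ℝ) ^ d ≤ ((blk U).card : ℝ) := by
      rw [blk_card, blockVol, ← mul_pow]
      push_cast
      calc (ε * (P.m : ℝ)) ^ d = ∏ i : Fin d, (ε * (P.m : ℝ)) := by simp
        _ ≤ _ := Finset.prod_le_prod (fun _ _ => by positivity) fun i _ => by
          have := hc i
          rwa [hpart] at this
    have hUpos : (0 : ℝ) < (blk U).card := lt_of_lt_of_le (by positivity) hvol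
    have hsub : blk U ⊆ blk (P.ordBlockSets γ) := by
      intro x hx
      simp only [blk, Finset.mem_filter, Finset.mem_univ, true_and] at hx ⊢
      exact fun i => hs i (hx i)
    have hdef := defect (plab P.p) (plab f) (ind A σ) (blk U) (by
        intro x y hxy
        simp only [blk, Finset.mem_filter, Finset.mem_univ, true_and]
        exact forall_congr' fun i => hfW i _ _ (congrFun hxy i) γ)
      (blockDensity A (P.ordBlockSets γ) σ) (blockDensity A U σ) (by
        intro x hx
        have hx' := hsub hx
        have hfib : (univ.filter fun y => plab P.p y = plab P.p x) = blk (P.ordBlockSets γ) := by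
          simp only [blk, Finset.mem_filter, Finset.mem_univ, true_and,
            BalancedPartition.ordBlockSets, BalancedPartition.part] at hx'
          ext y
          simp only [blk, Finset.mem_filter, Finset.mem_univ, true_and,
            BalancedPartition.ordBlockSets, BalancedPartition.part, plab, funext_iff, hx']
        unfold cavg blockDensity
        rw [hfib, blk_sum, blk_card])
      (by
        rw [blk_sum, blockDensity, ← blk_card]
        field_simp) (by exact_mod_cast hUpos)
    have hsq : ε ^ 2 ≤ (blockDensity A U σ - blockDensity A (P.ordBlockSets γ) σ) ^ 2 := by
      rw [← sq_abs (blockDensity A U σ - _)]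
      exact pow_le_pow_left₀ hε.le hd.le 2
    calc ε ^ (d + 2) * (P.m : ℝ) ^ d = (ε ^ d * (P.m : ℝ) ^ d) * ε ^ 2 := by ring
      _ ≤ ((blk U).card : ℝ) *
          (blockDensity A U σ - blockDensity A (P.ordBlockSets γ) σ) ^ 2 := by gcongr
      _ ≤ _ := hdef
      _ ≤ ∑ x ∈ blk U, F x := Finset.sum_le_sum fun x _ =>
          Finset.single_le_sum (f := fun σ => (cavg (plab f) (ind A σ) x -
            cavg (plab P.p) (ind A σ) x) ^ 2) (fun _ _ => sq_nonneg _) (Finset.mem_univ σ)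
      _ ≤ _ := Finset.sum_le_sum_of_subset_of_nonneg hsub fun x _ _ => hF0 x
  have hdisj : (I : Set (Fin d → Fin P.t)).PairwiseDisjoint
      (fun γ => blk (P.ordBlockSets γ)) := by
    intro γ _ γ' _ hne
    refine Finset.disjoint_left.2 fun x hx hx' => hne ?_
    simp only [blk, Finset.mem_filter, Finset.mem_univ, true_and,
            BalancedPartition.ordBlockSets, BalancedPartition.part] at hx hx'
    funext i
    have := (hx i).symm.trans (hx' i)
    exact Sum.inl.inj this
  have hsum : (I.card : ℝ) * (ε ^ (d + 2) * (P.m : ℝ) ^ d) ≤ ∑ x, F x := by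
    rw [← nsmul_eq_mul]
    calc _ ≤ ∑ γ ∈ I, ∑ x ∈ blk (P.ordBlockSets γ), F x := Finset.card_nsmul_le_sum _ _ _ hblk
      _ = ∑ x ∈ I.biUnion (fun γ => blk (P.ordBlockSets γ)), F x :=
          (Finset.sum_biUnion hdisj).symm
      _ ≤ _ := Finset.sum_le_univ_sum_of_nonneg hF0
  rw [hIc] at hirr
  calc ε ^ (d + 3) / 2 * (n : ℝ) ^ d = ε ^ (d + 3) * ((1 / 2) * (n : ℝ) ^ d) := by ring
    _ ≤ ε ^ (d + 3) * ((P.t : ℝ) * P.m) ^ d := by gcongr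
    _ = (ε * (P.t : ℝ) ^ d) * (ε ^ (d + 2) * (P.m : ℝ) ^ d) := by rw [mul_pow]; ring
    _ ≤ (I.card : ℝ) * (ε ^ (d + 2) * (P.m : ℝ) ^ d) := by gcongr
    _ ≤ _ := hsum

lemma exceptVol_eq {d n : ℕ} (P : BalancedPartition d n) :
    P.exceptVol + (P.t * P.m) ^ d = n ^ d := by
  classical
  have h1 : ∑ β : (∀ i, Fin P.t ⊕ Fin (P.e i)), ∏ i, (P.part i (β i)).card = n ^ d := by
    rw [← Fintype.piFinset_univ, ← Finset.prod_univ_sum (fun i => (univ : Finset (Fin P.t ⊕ Fin (P.e i))))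
      (fun i c => (P.part i c).card)]
    have : ∀ i, ∑ c, (P.part i c).card = n := by
      intro i
      have := Finset.card_eq_sum_card_fiberwise (f := P.p i) (s := univ) (t := univ)
        (fun _ _ => by simp)
      simpa [BalancedPartition.part] using this.symm
    simp [this]
  have h2 : ∑ β ∈ univ.filter (fun β : ∀ i, Fin P.t ⊕ Fin (P.e i) => ¬ ∃ i, (β i).isRight),
      ∏ i, (P.part i (β i)).card = (P.t * P.m) ^ d := by
    have h3 : univ.filter (fun β : ∀ i, Fin P.t ⊕ Fin (P.e i) => ¬ ∃ i, (β i).isRight) =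
        (univ : Finset (Fin d → Fin P.t)).image (fun γ i => Sum.inl (γ i)) := by
      ext β
      simp only [Finset.mem_filter, Finset.mem_univ, true_and, Finset.mem_image]
      constructor
      · intro h
        have : ∀ i, ∃ a, Sum.inl a = β i := by
          intro i
          rcases hb : β i with a | a
          · exact ⟨a, rfl⟩
          · exact absurd ⟨i, by simp [hb]⟩ h
        choose γ hγ using this
        exact ⟨γ, funext hγ⟩
      · rintro ⟨γ, rfl⟩
        simp
    rw [h3, Finset.sum_image]
    · have : ∀ (γ : Fin d → Fin P.t) i, (P.part i (Sum.inl (γ i))).card = P.m :=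
        fun γ i => P.balanced i (γ i)
      simp [this, mul_pow]
    · intro γ _ γ' _ h
      funext i
      exact Sum.inl.inj (congrFun h i)
  rw [← h1, ← h2]
  exact Finset.sum_filter_add_sum_filter_not _ _ _

lemma iter (d : ℕ) (hd : 1 ≤ d) (ε : ℝ) (hε : 0 < ε) (hε' : ε < 1 / 2) (s : ℕ) :
    ∀ k : ℕ, ∃ N T : ℕ, ∀ (Sig : Type) [Fintype Sig] [DecidableEq Sig],
      ∀ n : ℕ, N ≤ n → ∀ A : (Fin d → Fin n) → Sig, ∀ f : Fin d → Fin n → Fin k,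
        (n : ℝ) ^ d - s * ((ε ^ (d + 3) / 2) * (n : ℝ) ^ d) < toten A f →
        ∃ P : BalancedPartition d n, P.IsRegularPartition ε A ∧ P.t ^ d ≤ T := by
  induction s with
  | zero =>
    intro k
    refine ⟨0, 0, ?_⟩
    intro Sig _ _ n _ A f h
    have := toten_le A f
    simp at h
    linarith
  | succ s ih =>
    intro k
    have hdpos : (0 : ℝ) < d := by exact_mod_cast hd
    set δ : ℝ := ε / (2 * d) with hδ
    have hδ0 : 0 < δ := by positivity
    obtain ⟨t, ht⟩ := exists_nat_ge ((k : ℝ) / δ)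
    rw [div_le_iff₀ hδ0] at ht
    obtain ⟨N₀, hN₀⟩ := exists_nat_ge (((t : ℝ) + k) / δ)
    rw [div_le_iff₀ hδ0] at hN₀
    obtain ⟨N', T', hN'⟩ := ih ((t + k) * 2 ^ (t ^ d))
    refine ⟨max N' (max N₀ (t + k + 1)), max T' (t ^ d), ?_⟩
    intro Sig _ _ n hn A f hf
    have hn1 : N' ≤ n := le_trans (le_max_left _ _) hn
    have hn2 : N₀ ≤ n := le_trans (le_trans (le_max_left _ _) (le_max_right _ _)) hn
    have hn3 : t + k + 1 ≤ n := le_trans (le_trans (le_max_right _ _) (le_max_right _ _)) hn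
    have hk : 1 ≤ k := by
      have := (f ⟨0, hd⟩ ⟨0, by omega⟩).pos
      omega
    set m := n / (t + k) with hm
    have hm1 : 1 ≤ m := (Nat.one_le_div_iff (by omega)).2 (by omega)
    have hmn : t * m + k * m ≤ n := by
      rw [← add_mul]; exact Nat.mul_div_le n (t + k)
    have hmn2 : n ≤ (t + k) * m + (t + k) := by
      have h1 := Nat.div_add_mod n (t + k)
      have h2 := Nat.mod_lt n (show 0 < t + k by omega)
      rw [← hm] at h1
      omega
    choose p hp1 hp2 hp3 using fun i => chunk (f i) m hm1 t hmn
    let P : BalancedPartition d n := ⟨t, m, fun _ => k, p, hp1⟩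
    have hPt : P.t = t := rfl
    have hPm : P.m = m := rfl
    have hmnR : (t : ℝ) * m + k * m ≤ n := by exact_mod_cast hmn
    have hmn2R : (n : ℝ) ≤ (t + k) * m + (t + k) := by exact_mod_cast hmn2
    have hnR : (N₀ : ℝ) ≤ n := by exact_mod_cast hn2
    have hnpos : (0 : ℝ) < n := by
      have : 0 < n := by omega
      exact_mod_cast this
    have htm : (1 - 2 * δ) * n ≤ (t : ℝ) * m := by
      have h1 : (k : ℝ) * m ≤ δ * n := by
        calc (k : ℝ) * m ≤ (t * δ) * m := by gcongr
          _ = δ * (t * m) := by ring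
          _ ≤ δ * n := by
            gcongr
            have : (0 : ℝ) ≤ k * m := by positivity
            linarith
      have h2 : (t : ℝ) + k ≤ δ * n := by
        calc (t : ℝ) + k ≤ N₀ * δ := hN₀
          _ ≤ n * δ := by gcongr
          _ = _ := by ring
      linarith
    have h2δ : 2 * δ * d = ε := by rw [hδ]; field_simp
    have hδ1 : 2 * δ ≤ 1 := by
      have : (1 : ℝ) ≤ d := by exact_mod_cast hd
      nlinarith
    have hbern : (1 - ε) * (n : ℝ) ^ d ≤ ((t : ℝ) * m) ^ d := by
      have h1 : 1 + (d : ℝ) * (-(2 * δ)) ≤ (1 + -(2 * δ)) ^ d :=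
        one_add_mul_le_pow (by linarith) d
      have h2 : 1 - ε ≤ (1 - 2 * δ) ^ d := by
        rw [← sub_eq_add_neg] at h1
        linarith
      calc (1 - ε) * (n : ℝ) ^ d ≤ (1 - 2 * δ) ^ d * (n : ℝ) ^ d := by gcongr
        _ = ((1 - 2 * δ) * n) ^ d := by rw [mul_pow]
        _ ≤ _ := by
          have : 0 ≤ (1 - 2 * δ) * n := mul_nonneg (by linarith) hnpos.le
          gcongr
    have hexc : (P.exceptVol : ℝ) ≤ ε * (n : ℝ) ^ d := by
      have h1 : (P.exceptVol : ℝ) + ((t : ℝ) * m) ^ d = (n : ℝ) ^ d := by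
        exact_mod_cast exceptVol_eq P
      linarith
    by_cases hreg : ({γ : Fin d → Fin P.t | ¬ IsRegularBlock ε A (P.ordBlockSets γ)}.ncard : ℝ) ≤
        ε * (P.t : ℝ) ^ d
    · exact ⟨P, ⟨hexc, hreg⟩, le_max_right _ _⟩
    · push Not at hreg
      have hnd : (0 : ℝ) < (n : ℝ) ^ d := by positivity
      obtain ⟨f', hf'⟩ := increment (k := k) (t := t) ε hε A P hm1 rfl (fun _ => rfl)
        (by
          refine le_trans ?_ hbern
          gcongr
          linarith) hreg
      have hmono : toten A f ≤ toten A P.p := toten_mono A f P.p hp3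
      obtain ⟨Q, hQ, hQt⟩ := hN' Sig n hn1 A f' (by push_cast at hf; linarith)
      exact ⟨Q, hQ, hQt.trans (le_max_left _ _)⟩

/-- **Regularity lemma for multidimensional matrices.**  For every `d ≥ 1` and every
`0 < ε < 1/2` there are `N, T ∈ ℕ` such that every `d`-dimensional matrix `A` of order
`n ≥ N` over a finite alphabet admits an `ε`-regular balanced block partition `𝓑`
whose cardinality `|𝓑| = t^d` is at most `T`. -/
theorem regularity_lemma_multidimensional (d : ℕ) (hd : 1 ≤ d)
    (ε : ℝ) (hε : 0 < ε) (hε' : ε < 1 / 2) :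
    ∃ N T : ℕ, ∀ (Sig : Type) [Fintype Sig] [DecidableEq Sig],
      ∀ n : ℕ, N ≤ n → ∀ A : (Fin d → Fin n) → Sig,
        ∃ P : BalancedPartition d n, P.IsRegularPartition ε A ∧ P.t ^ d ≤ T := by
  obtain ⟨s, hs⟩ := exists_nat_gt (1 / (ε ^ (d + 3) / 2))
  have hc : 0 < ε ^ (d + 3) / 2 := by positivity
  rw [div_lt_iff₀ hc] at hs
  obtain ⟨N, T, h⟩ := iter d hd ε hε hε' s 1
  refine ⟨max N 1, T, ?_⟩
  intro Sig _ _ n hn A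
  have hn1 : 1 ≤ n := le_trans (le_max_right _ _) hn
  refine h Sig n (le_trans (le_max_left _ _) hn) A (fun _ _ => 0) ?_
  refine lt_of_lt_of_le ?_ (toten_nonneg A _)
  have hnd : (0 : ℝ) < (n : ℝ) ^ d := by
    have : (0 : ℝ) < n := by exact_mod_cast hn1
    positivity
  nlinarith
end
end

section
/- Counting lemma for multidimensional matrices: For any δ > 0, any integers d ≥ 2 and t_1,…,t_d ≥ 1, any finite alphabet Σ, any matrix C = (c_β) of sizes t_1 × … × t_d over Σ, and any reals ρ_β ∈ (0,1] for β = (β_1,…,β_d) with β_i ∈ {1,…,t_i}, there exists ε > 0 such that the following holds. Let A be a d-dimensional matrix over Σ with a block partition 𝓑 = {B_β} given by partitioning, for each direction i, the index set of that direction into sets S^i_1,…,S^i_{t_i} with |S^i_j| = m^i_j, so that B_β = S^1_{β_1} × … × S^d_{β_d}. Suppose every block B_β is an ε-regular pattern (of sizes m^1_{β_1} × … × m^d_{β_d}) whose density of the symbol c_β equals ρ_β. Then the number of tuples of indices (x^i_j)_{1 ≤ i ≤ d, 1 ≤ j ≤ t_i} with x^i_j ∈ S^i_j and a_{x^1_{β_1},…,x^d_{β_d}}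 = c_β for all β is at least (1 − δ) · ∏_{i=1}^d ∏_{j=1}^{t_i} m^i_j · ∏_β ρ_β. -/
/-
STATEMENT 11: Counting lemma for multidimensional matrices: for any δ > 0, d ≥ 2,
t_1,…,t_d ≥ 1, finite alphabet Σ, matrix C of sizes t_1 × … × t_d over Σ and densities
ρ_β ∈ (0,1], there is ε > 0 such that: whenever A is a d-dimensional matrix over Σ
with a block partition 𝓑 = {B_β} (the index set of direction i partitioned into sets
S^i_1,…,S^i_{t_i} with |S^i_j| = m^i_j) all of whose blocks B_β are ε-regular patterns
with density of the symbol c_β equal to ρ_β, the number of aligned appearances of C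
in A is at least (1 − δ)·∏_{i,j} m^i_j·∏_β ρ_β.
-/

open Finset

noncomputable section

/-- The density of the symbol `σ` in a matrix with entries in `Option T`
(`none` is the blank symbol, not belonging to the alphabet `T`). -/
def matDensity {d : ℕ} {n : Fin d → ℕ} {T : Type*} [DecidableEq T]
    (A : (∀ i, Fin (n i)) → Option T) (σ : T) : ℝ :=
  ((Finset.univ.filter fun α : ∀ i, Fin (n i) => A α = some σ).card : ℝ) /
    ((Finset.univ : Finset (∀ i, Fin (n i))).card : ℝ)

/-- The entrywise product of a matrix `A` over `Option T` with a binary matrix `P`: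
positions where `P` is `0` get the blank symbol `none`. -/
def entryProd {d : ℕ} {n : Fin d → ℕ} {T : Type*}
    (A : (∀ i, Fin (n i)) → Option T) (P : (∀ i, Fin (n i)) → Bool) :
    (∀ i, Fin (n i)) → Option T :=
  fun α => if P α then A α else none

/-- The hyperplane of direction `i` at height `x` of a `(d+1)`-dimensional matrix. -/
def hyperplane {d : ℕ} {n : Fin (d + 1) → ℕ} {T : Type*}
    (A : (∀ i, Fin (n i)) → Option T) (i : Fin (d + 1)) (x : Fin (n i)) :
    (∀ j : Fin d, Fin (n (i.succAbove j))) → Option T :=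
  fun α => A (i.insertNth x α)

/-- `ε`-regular binary patterns (entries in `Option Bool`, `none` being the blank
symbol), with density vector `ρ : Bool → ℝ`, defined by induction on the dimension:
a 1-dimensional pattern is any 1-dimensional matrix whose density of each symbol `b`
equals `ρ b`; a `d`-dimensional matrix (`d ≥ 2`) is an `ε`-regular pattern with
densities `ρ` if for every direction `i` and every `(d−1)`-dimensional binary
`ε`-regular pattern `Q` (with blank-free entries) with density `ρQ true ≥ ε` of the
symbol `1`, for at least `(1−ε)·n i` of the `n i` hyperplanes `Γ` of direction `i`,
the entrywise product of `Γ` with `Q` is a `(d−1)`-dimensional `ε`-regular pattern for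
some density vector `ρ''` with `ρ'' b ≥ ρ b · ρQ true · (1−ε)` for every symbol `b`. -/
def IsBinPattern (ε : ℝ) : (d : ℕ) → (n : Fin d → ℕ) →
    ((∀ i, Fin (n i)) → Option Bool) → (Bool → ℝ) → Prop
  | 0, _, _, _ => True
  | 1, _, P, ρ => ∀ b, matDensity P b = ρ b
  | (d + 2), n, P, ρ =>
      ∀ (i : Fin (d + 2)) (Q : (∀ j : Fin (d + 1), Fin (n (i.succAbove j))) → Bool)
        (ρQ : Bool → ℝ),
        IsBinPattern ε (d + 1) (fun j => n (i.succAbove j)) (fun α => some (Q α)) ρQ →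
        ε ≤ ρQ true →
        (1 - ε) * (n i : ℝ) ≤
          ({x : Fin (n i) | ∃ ρ'' : Bool → ℝ,
              (∀ b, ρ b * ρQ true * (1 - ε) ≤ ρ'' b) ∧
              IsBinPattern ε (d + 1) (fun j => n (i.succAbove j))
                (entryProd (hyperplane P i x) Q) ρ''}.ncard : ℝ)

/-- `ε`-regular patterns over the alphabet `T` (entries in `Option T`, `none` being the
blank symbol), with density vector `ρ : T → ℝ`, defined by induction on the dimension:
a 1-dimensional pattern is any 1-dimensional matrix whose density of each symbol `σ`
equals `ρ σ`; a `d`-dimensional matrix (`d ≥ 2`) is an `ε`-regular pattern with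
densities `ρ` if for every direction `i` and every `(d−1)`-dimensional binary
`ε`-regular pattern `P` (with blank-free entries) with density `ρP true ≥ ε` of the
symbol `1`, for at least `(1−ε)·n i` of the `n i` hyperplanes `Γ` of direction `i`,
the entrywise product of `Γ` with `P` is a `(d−1)`-dimensional `ε`-regular pattern for
some density vector `ρ''` with `ρ'' σ ≥ ρ σ · ρP true · (1−ε)` for every symbol `σ`. -/
def IsRegPattern {T : Type*} [DecidableEq T] (ε : ℝ) : (d : ℕ) → (n : Fin d → ℕ) →
    ((∀ i, Fin (n i)) → Option T) → (T → ℝ) → Prop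
  | 0, _, _, _ => True
  | 1, _, A, ρ => ∀ σ, matDensity A σ = ρ σ
  | (d + 2), n, A, ρ =>
      ∀ (i : Fin (d + 2)) (P : (∀ j : Fin (d + 1), Fin (n (i.succAbove j))) → Bool)
        (ρP : Bool → ℝ),
        IsBinPattern ε (d + 1) (fun j => n (i.succAbove j)) (fun α => some (P α)) ρP →
        ε ≤ ρP true →
        (1 - ε) * (n i : ℝ) ≤
          ({x : Fin (n i) | ∃ ρ'' : T → ℝ,
              (∀ σ, ρ σ * ρP true * (1 - ε) ≤ ρ'' σ) ∧
              IsRegPattern ε (d + 1) (fun j => n (i.succAbove j))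
                (entryProd (hyperplane A i x) P) ρ''}.ncard : ℝ)

/-- Binary blank-free pattern with density of `true` at least `a`. -/
def PatGE (ε : ℝ) (d : ℕ) (n : Fin d → ℕ) (Q : (∀ i, Fin (n i)) → Bool) (a : ℝ) : Prop :=
  ∃ ρ : Bool → ℝ, a ≤ ρ true ∧ IsBinPattern ε d n (fun α => some (Q α)) ρ

theorem isReg_bool_iff (ε : ℝ) (d : ℕ) : ∀ (n : Fin d → ℕ)
    (A : (∀ i, Fin (n i)) → Option Bool) (ρ : Bool → ℝ),
    IsRegPattern ε d n A ρ ↔ IsBinPattern ε d n A ρ := by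
  induction d with
  | zero => intro n A ρ; simp [IsRegPattern, IsBinPattern]
  | succ d ih =>
    cases d with
    | zero => intro n A ρ; simp only [IsRegPattern, IsBinPattern]
    | succ d => intro n A ρ; simp only [IsRegPattern, IsBinPattern, ih]

theorem matDensity_nonneg {d : ℕ} {n : Fin d → ℕ} {T : Type*} [DecidableEq T]
    (A : (∀ i, Fin (n i)) → Option T) (σ : T) : 0 ≤ matDensity A σ := by
  unfold matDensity; positivity

theorem indicator_pattern {T : Type*} [DecidableEq T] (ε : ℝ) (σ : T) (d : ℕ) :
    ∀ (n : Fin (d+1) → ℕ) (A : (∀ i, Fin (n i)) → Option T) (ρ : T → ℝ)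
      (B : (∀ i, Fin (n i)) → Option Bool),
      (∀ α, B α = some true ↔ A α = some σ) → IsRegPattern ε (d+1) n A ρ →
      ∃ ρ' : Bool → ℝ, ρ' true = ρ σ ∧ 0 ≤ ρ' false ∧ IsBinPattern ε (d+1) n B ρ' := by
  induction d with
  | zero =>
    intro n A ρ B hB hA
    refine ⟨matDensity B, ?_, matDensity_nonneg _ _, ?_⟩
    · simp only [IsRegPattern] at hA
      rw [← hA σ]; unfold matDensity; simp only [hB]
    · simp [IsBinPattern]
  | succ d ih =>
    intro n A ρ B hB hA
    refine ⟨fun b => if b then ρ σ else 0, by simp, by simp, ?_⟩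
    simp only [IsRegPattern] at hA
    simp only [IsBinPattern]
    intro i Q ρQ hQ hε
    refine (hA i Q ρQ hQ hε).trans ?_
    norm_cast
    apply Set.ncard_le_ncard _ (Set.toFinite _)
    rintro x ⟨ρ'', h1, h2⟩
    obtain ⟨ρ', ha, hb, hc⟩ := ih _ _ ρ'' (entryProd (hyperplane B i x) Q) (by
      intro α
      simp only [entryProd, hyperplane]
      split_ifs
      · exact hB _
      · simp) h2
    refine ⟨ρ', ?_, hc⟩
    intro b
    cases b
    · simpa using hb
    · simpa [ha] using h1 σ

theorem ones_pattern (ε : ℝ) (hε : 0 < ε) (d : ℕ) (n : Fin (d+1) → ℕ) (hn : ∀ i, 0 < n i) :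
    PatGE ε (d+1) n (fun _ => true) 1 := by
  cases d with
  | zero =>
    refine ⟨matDensity (n := n) (fun _ => some true), ?_, ?_⟩
    · unfold matDensity
      have : ∀ i, (n i : ℝ) ≠ 0 := fun i => by exact_mod_cast (hn i).ne'
      simp [this]
    · simp [IsBinPattern]
  | succ d =>
    refine ⟨fun b => if b then 1 else 0, by simp, ?_⟩
    simp only [IsBinPattern]
    intro i Q ρQ hQ hερ
    have key : ∀ x : Fin (n i), x ∈ {x : Fin (n i) | ∃ ρ'' : Bool → ℝ,
              (∀ b : Bool, (if b then (1:ℝ) else 0) * ρQ true * (1 - ε) ≤ ρ'' b) ∧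
              IsBinPattern ε (d + 1) (fun j => n (i.succAbove j))
                (entryProd (hyperplane (fun _ => some true) i x) Q) ρ''} := by
      intro x
      obtain ⟨ρ', ha, hb, hc⟩ := indicator_pattern ε true d _ _ ρQ
        (entryProd (hyperplane (n := n) (fun _ => some true) i x) Q) (by
          intro α
          simp [entryProd, hyperplane]) ((isReg_bool_iff _ _ _ _ _).2 hQ)
      refine ⟨ρ', ?_, hc⟩
      intro b
      cases b
      · simpa using hb
      · simp [ha]; nlinarith
    rw [Set.eq_univ_of_forall key]
    simp
    have : (0:ℝ) ≤ n i := by positivity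
    nlinarith

theorem step_pattern (ε r : ℝ) (hε : 0 < ε) (hε1 : ε ≤ 1) (hr : 0 ≤ r) (d : ℕ)
    (n : Fin (d+2) → ℕ)
    (P : (∀ i, Fin (n i)) → Bool) (hP : PatGE ε (d+2) n P r)
    (Q : (∀ j : Fin (d+1), Fin (n j.succ)) → Bool) (a : ℝ)
    (hQ : PatGE ε (d+1) (fun j => n j.succ) Q a) (ha : ε ≤ a) :
    (1 - ε) * (n 0 : ℝ) ≤ ({x : Fin (n 0) | PatGE ε (d+1) (fun j => n j.succ)
      (fun α => Q α && P (Fin.cons x α)) (a * (r * (1-ε)))}.ncard : ℝ) := by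
  obtain ⟨ρP, hρP, hP⟩ := hP
  obtain ⟨ρQ, hρQ, hQ⟩ := hQ
  simp only [IsBinPattern] at hP
  refine (hP 0 Q ρQ hQ (ha.trans hρQ)).trans ?_
  norm_cast
  apply Set.ncard_le_ncard _ (Set.toFinite _)
  rintro x ⟨ρ'', h1, h2⟩
  have hins : ∀ α : (∀ j : Fin (d+1), Fin (n j.succ)),
      (Fin.insertNth 0 x α : ∀ i, Fin (n i)) = Fin.cons x α := by
    intro α
    funext i
    refine Fin.cases ?_ (fun j => ?_) i
    · exact Fin.insertNth_apply_same (α := fun i => Fin (n i)) 0 x α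
    · exact Fin.insertNth_apply_succAbove (α := fun i => Fin (n i)) 0 x α j
  obtain ⟨ρ', hA, hB, hC⟩ := indicator_pattern ε true d _ _ ρ''
    (fun α => some (Q α && P (Fin.cons x α))) (by
      intro α
      simp only [entryProd, hyperplane]
      have : Q α = true ∨ Q α = false := by cases Q α <;> simp
      rcases this with h | h <;> simp [h]
      rw [← hins α]) ((isReg_bool_iff _ _ _ _ _).2 h2)
  refine ⟨ρ', ?_, hC⟩
  rw [hA]
  refine le_trans ?_ (h1 true)
  have : a * r ≤ ρQ true * ρP true := by
    apply mul_le_mul hρQ hρP hr; linarith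
  nlinarith

theorem card_good_ext {B : Type*} [Fintype B] (N : ℕ) (ε : ℝ) (G : B → Set (Fin N))
    (h : ∀ b, (1 - ε) * (N : ℝ) ≤ ((G b).ncard : ℝ)) :
    (1 - Fintype.card B * ε) * (N : ℝ) ≤ (({x | ∀ b, x ∈ G b} : Set (Fin N)).ncard : ℝ) := by
  classical
  have h1 : ({x | ∀ b, x ∈ G b} : Set (Fin N))ᶜ.ncard ≤ ∑ b, ((G b)ᶜ).ncard := by
    have : ({x | ∀ b, x ∈ G b} : Set (Fin N))ᶜ = ⋃ b, (G b)ᶜ := by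
      ext x; simp
    rw [this]
    exact Set.ncard_iUnion_le_of_fintype _
  have hc : ∀ S : Set (Fin N), (S.ncard : ℝ) + (Sᶜ.ncard : ℝ) = N := by
    intro S
    have := Set.ncard_add_ncard_compl S
    simp at this
    exact_mod_cast this
  have h2 : (({x | ∀ b, x ∈ G b} : Set (Fin N))ᶜ.ncard : ℝ) ≤ ∑ b, (((G b)ᶜ).ncard : ℝ) := by
    exact_mod_cast h1
  have h3 : ∑ b : B, (((G b)ᶜ).ncard : ℝ) ≤ ∑ _b : B, ε * N := by
    apply Finset.sum_le_sum
    intro b _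
    have := h b; have := hc (G b); linarith
  simp at h3
  have := hc {x | ∀ b, x ∈ G b}
  linarith

theorem ncard_cons_ge {s : ℕ} (M : Fin (s+1) → Type*) [∀ k, Fintype (M k)] (S : Set (∀ k, M k))
    (G : Set (M 0)) (c : ℝ) 
    (h : ∀ x ∈ G, c ≤ (({y : ∀ k : Fin s, M k.succ | Fin.cons x y ∈ S} : Set _).ncard : ℝ)) :
    (G.ncard : ℝ) * c ≤ (S.ncard : ℝ) := by
  classical
  have e : (S.ncard) = ∑ x : M 0, ({y : ∀ k : Fin s, M k.succ | Fin.cons x y ∈ S} : Set _).ncard := by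
    simp only [← Nat.card_coe_set_eq]
    rw [← Nat.card_sigma]
    refine Nat.card_congr ?_
    exact {
      toFun := fun z => ⟨z.1 0, ⟨fun k => z.1 k.succ, by
        have := z.2; simp only [Set.mem_ofPred_eq]
        convert this
        exact Fin.cons_self_tail _⟩⟩
      invFun := fun w => ⟨Fin.cons w.1 w.2.1, w.2.2⟩
      left_inv := fun z => by ext1; exact Fin.cons_self_tail _
      right_inv := fun w => rfl }
  rw [e]
  push_cast
  have : G.ncard = G.toFinset.card := Set.ncard_eq_toFinset_card' G
  rw [this, ← nsmul_eq_mul, ← Finset.sum_const]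
  refine (Finset.sum_le_sum (fun x hx => h x (by simpa using hx))).trans ?_
  exact Finset.sum_le_sum_of_subset_of_nonneg (Finset.subset_univ _) (fun _ _ _ => by positivity)

theorem seq_lemma {B : Type*} [Fintype B] {X : B → Type*}
    (Pat : ∀ b, (X b → Bool) → ℝ → Prop) (ε : ℝ) (hε : 0 < ε)
    (hε1 : ε ≤ 1) (hB : Fintype.card B * ε ≤ 1) (s : ℕ) :
    ∀ (M : Fin s → ℕ) (P : ∀ k b, Fin (M k) → X b → Bool) (r : Fin s → B → ℝ)
      (_ : ∀ k b, 0 ≤ r k b) (_ : ∀ k b, r k b ≤ 1)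
      (_ : ∀ k b Q a, Pat b Q a → ε ≤ a → (1 - ε) * (M k : ℝ) ≤
        ({x | Pat b (fun α => Q α && P k b x α) (a * (r k b * (1-ε)))}.ncard : ℝ))
      (Q : ∀ b, X b → Bool) (a : B → ℝ) (_ : ∀ b, Pat b (Q b) (a b))
      (_ : ∀ b, 0 ≤ a b)
      (_ : ∀ b, ε ≤ a b * ∏ k, (r k b * (1 - ε))),
      (1 - Fintype.card B * ε)^s * ∏ k, (M k : ℝ) ≤
        ({x : ∀ k, Fin (M k) | ∀ b, Pat b (fun α => Q b α && decide (∀ k, P k b (x k) α))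
          (a b * ∏ k, (r k b * (1 - ε)))}.ncard : ℝ) := by
  induction s with
  | zero =>
    intro M P r _ _ hstep Q a hQ ha hae
    simp [hQ]
  | succ s ih =>
    intro M P r hr0 hr1 hstep Q a hQ ha hae
    have hp : ∀ b, ∏ k : Fin s, (r k.succ b * (1 - ε)) ≤ 1 := fun b =>
      Finset.prod_le_one (fun k _ => mul_nonneg (hr0 _ _) (by linarith))
        (fun k _ => mul_le_one₀ (hr1 _ _) (by linarith) (by linarith))
    have hp0 : ∀ b, 0 ≤ ∏ k : Fin s, (r k.succ b * (1 - ε)) := fun b =>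
      Finset.prod_nonneg (fun k _ => mul_nonneg (hr0 _ _) (by linarith))
    have h0 : ∀ b, 0 ≤ r 0 b * (1 - ε) := fun b => mul_nonneg (hr0 _ _) (by linarith)
    have h01 : ∀ b, r 0 b * (1 - ε) ≤ 1 := fun b =>
      mul_le_one₀ (hr1 _ _) (by linarith) (by linarith)
    have hεa : ∀ b, ε ≤ a b := by
      intro b
      refine (hae b).trans ?_
      rw [Fin.prod_univ_succ]
      exact mul_le_of_le_one_right (ha b) (mul_le_one₀ (h01 b) (hp0 b) (hp b))
    have hG := card_good_ext (M 0) ε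
      (fun b => {x | Pat b (fun α => Q b α && P 0 b x α) (a b * (r 0 b * (1-ε)))})
      (fun b => hstep 0 b (Q b) (a b) (hQ b) (hεa b))
    have hc := ncard_cons_ge (fun k => Fin (M k)) {x : ∀ k, Fin (M k) | ∀ b, Pat b
        (fun α => Q b α && decide (∀ k, P k b (x k) α)) (a b * ∏ k, (r k b * (1 - ε)))}
      {x | ∀ b, x ∈ {x | Pat b (fun α => Q b α && P 0 b x α) (a b * (r 0 b * (1-ε)))}}
      ((1 - Fintype.card B * ε)^s * ∏ k : Fin s, (M k.succ : ℝ)) (by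
        intro x hx
        have := ih (fun k => M k.succ) (fun k => P k.succ) (fun k => r k.succ)
          (fun k => hr0 _) (fun k => hr1 _) (fun k => hstep _)
          (fun b α => Q b α && P 0 b x α) (fun b => a b * (r 0 b * (1-ε))) hx
          (fun b => mul_nonneg (ha b) (h0 b)) (by
            intro b
            have := hae b
            rw [Fin.prod_univ_succ, ← mul_assoc] at this
            exact this)
        refine this.trans ?_
        norm_cast
        apply Set.ncard_le_ncard _ (Set.toFinite _)
        intro y hy b
        have := hy b
        rw [Fin.prod_univ_succ, ← mul_assoc]
        convert this using 2
        rw [Bool.and_assoc]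
        congr 1
        rw [Bool.eq_iff_iff]
        simp [Fin.forall_fin_succ])
    refine le_trans ?_ hc
    rw [Fin.prod_univ_succ, pow_succ]
    have hnn : 0 ≤ (1 - Fintype.card B * ε)^s * ∏ k : Fin s, (M k.succ : ℝ) :=
      mul_nonneg (pow_nonneg (by linarith) _) (by positivity)
    have := mul_le_mul_of_nonneg_right hG hnn
    refine le_trans (le_of_eq ?_) this
    ring

theorem PatGE.mono {ε : ℝ} {d : ℕ} {n : Fin d → ℕ} {Q : (∀ i, Fin (n i)) → Bool} {a b : ℝ}
    (h : PatGE ε d n Q a) (hab : b ≤ a) : PatGE ε d n Q b := by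
  obtain ⟨ρ, h1, h2⟩ := h
  exact ⟨ρ, hab.trans h1, h2⟩

/-- The counting statement for binary patterns in dimension `d`. -/
def CountS (d : ℕ) : Prop :=
  ∀ (t : Fin d → ℕ) (r : (∀ i, Fin (t i)) → ℝ), (∀ β, 0 < r β) → (∀ β, r β ≤ 1) →
    ∀ δ : ℝ, 0 < δ → ∃ ε0 : ℝ, 0 < ε0 ∧ ∀ ε : ℝ, 0 < ε → ε ≤ ε0 →
      ∀ (m : ∀ i, Fin (t i) → ℕ)
        (P : ∀ β : (∀ i, Fin (t i)), (∀ i, Fin (m i (β i))) → Bool),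
        (∀ β, PatGE ε d (fun i => m i (β i)) (P β) (r β)) →
        (1 - δ) * (∏ i, ∏ j, (m i j : ℝ)) * (∏ β, r β) ≤
          ({x : ∀ i, (j : Fin (t i)) → Fin (m i j) |
            ∀ β, P β (fun i => x i (β i)) = true}.ncard : ℝ)

theorem prod_cons_eq {d : ℕ} (t : Fin (d+1) → ℕ) (r : (∀ i, Fin (t i)) → ℝ) :
    ∏ β, r β = ∏ β' : (∀ i : Fin d, Fin (t i.succ)), ∏ j : Fin (t 0), r (Fin.cons j β') := by
  rw [Finset.prod_comm, ← Fintype.prod_prod_type']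
  exact (Fintype.prod_equiv (Fin.consEquiv (fun i => Fin (t i))) _ _ (fun x => rfl)).symm

theorem countS_one : CountS 1 := by
  intro t r hr0 hr1 δ hδ
  refine ⟨1, one_pos, ?_⟩
  intro ε hε _hε1 m P hP
  classical
  let b : Fin (t 0) → (∀ i : Fin 1, Fin (t i)) := fun j => Fin.cons j (fun i => i.elim0)
  let D : ∀ j, Set (∀ i : Fin 1, Fin (m i (b j i))) := fun j => {α | P (b j) α = true}
  have hD : ∀ j, (m 0 j : ℝ) * r (b j) ≤ ((D j).ncard : ℝ) := by
    intro j
    obtain ⟨ρ, h1, h2⟩ := hP (b j)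
    simp only [IsBinPattern] at h2
    have h3 := h2 true
    rw [← h3] at h1
    have hu : ((Finset.univ : Finset (∀ i : Fin 1, Fin (m i (b j i)))).card : ℝ) = m 0 j := by
      simp [b]
    have hn : (((Finset.univ.filter fun α : ∀ i : Fin 1, Fin (m i (b j i)) =>
        some (P (b j) α) = some true).card : ℕ) : ℝ) = (D j).ncard := by
      congr 1
      rw [Set.ncard_eq_toFinset_card']
      congr 1
      ext α
      simp [D]
    unfold matDensity at h1
    rw [hu, hn] at h1
    rcases Nat.eq_zero_or_pos (m 0 j) with h | h
    · simp [h]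
    · have : (0:ℝ) < m 0 j := by exact_mod_cast h
      rw [le_div_iff₀ this] at h1
      linarith
  have hinj : ∏ j, (D j).ncard ≤ ({x : ∀ i, (j : Fin (t i)) → Fin (m i j) |
            ∀ β, P β (fun i => x i (β i)) = true}.ncard) := by
    simp only [← Nat.card_coe_set_eq]
    rw [← Nat.card_pi]
    refine Nat.card_le_card_of_injective
      (fun f => ⟨Fin.cons (fun j => (f j).1 0) (fun i => i.elim0), ?_⟩) ?_
    · intro β
      obtain ⟨j, rfl⟩ : ∃ j, β = b j := ⟨β 0, by
        funext i
        have : i = 0 := Subsingleton.elim _ _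
        subst this; rfl⟩
      have := (f j).2
      simp only [D, Set.mem_ofPred_eq] at this
      refine (congrArg (P (b j)) ?_).trans this
      funext i
      have : i = 0 := Subsingleton.elim _ _
      subst this; rfl
    · intro f g hfg
      have h1 := congrArg (fun z => z.1 0) hfg
      funext j
      ext1
      funext i
      have : i = 0 := Subsingleton.elim _ _
      subst this
      exact congrFun h1 j
  have hprod : ∏ β, r β = ∏ j, r (b j) := by
    rw [prod_cons_eq, Finset.prod_comm]
    refine Finset.prod_congr rfl (fun j _ => ?_)
    rw [Fintype.prod_unique]
    congr 1
  have h2 : (∏ i, ∏ j, (m i j : ℝ)) * (∏ β, r β) ≤ ∏ j, ((D j).ncard : ℝ) := by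
    rw [hprod, Fin.prod_univ_one, ← Finset.prod_mul_distrib]
    exact Finset.prod_le_prod (fun j _ => mul_nonneg (by positivity) (hr0 _).le) (fun j _ => hD j)
  have h3 : 0 ≤ (∏ i, ∏ j, (m i j : ℝ)) * (∏ β, r β) :=
    mul_nonneg (by positivity) (Finset.prod_nonneg (fun β _ => (hr0 β).le))
  have h4 : (∏ j, ((D j).ncard : ℝ)) ≤ ({x : ∀ i, (j : Fin (t i)) → Fin (m i j) |
            ∀ β, P β (fun i => x i (β i)) = true}.ncard : ℝ) := by exact_mod_cast hinj
  rw [mul_assoc]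
  nlinarith

theorem countS_succ (d : ℕ) (ih : CountS (d+1)) : CountS (d+2) := by
  classical
  intro t r hr0 hr1 δ hδ
  set K : ℕ := Fintype.card (∀ i : Fin (d+1), Fin (t i.succ)) with hK
  obtain ⟨δ1, hδ1, hδ1', hδ1d⟩ : ∃ δ1 : ℝ, 0 < δ1 ∧ δ1 ≤ 1/2 ∧ 1 - δ ≤ (1 - δ1)^(K+2) := by
    refine ⟨min (1/2) (δ/(K+2)), by positivity, min_le_left _ _, ?_⟩
    have h := one_add_mul_le_pow (a := -(min (1/2) (δ/(K+2)) : ℝ))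
      (by have := min_le_left (1/2 : ℝ) (δ/(K+2)); linarith) (K+2)
    rw [← sub_eq_add_neg] at h
    refine le_trans ?_ h
    have h2 := min_le_right (1/2 : ℝ) (δ/(K+2))
    rw [le_div_iff₀ (by positivity)] at h2
    push_cast
    linarith
  let r' : (∀ i : Fin (d+1), Fin (t i.succ)) → ℝ :=
    fun β' => (∏ j : Fin (t 0), r (Fin.cons j β')) * (1 - δ1)
  have hrp0 : ∀ β', 0 < r' β' := fun β' =>
    mul_pos (Finset.prod_pos (fun j _ => hr0 _)) (by linarith)
  have hrp1 : ∀ β', r' β' ≤ 1 := fun β' =>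
    mul_le_one₀ (Finset.prod_le_one (fun j _ => (hr0 _).le) (fun j _ => hr1 _))
      (by linarith) (by linarith)
  obtain ⟨ε1, hε1, H⟩ := ih (fun i => t i.succ) r' hrp0 hrp1 δ1 hδ1
  obtain ⟨ε2, hε2, H2⟩ : ∃ ε2 : ℝ, 0 < ε2 ∧ ∀ β', ε2 ≤ r' β' := by
    rcases isEmpty_or_nonempty (∀ i : Fin (d+1), Fin (t i.succ)) with h | h
    · exact ⟨1, one_pos, fun β' => (h.false β').elim⟩
    · obtain ⟨b, hb⟩ := Finite.exists_min r'
      exact ⟨r' b, hrp0 b, hb⟩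
  set ε3 : ℝ := δ1 / ((t 0 + 1) * (K + 1)) with hε3
  have hε3p : 0 < ε3 := by positivity
  refine ⟨min ε1 (min ε2 ε3), by positivity, ?_⟩
  intro ε hε hεle m P hP
  have he1 : ε ≤ ε1 := hεle.trans (min_le_left _ _)
  have he2 : ε ≤ ε2 := hεle.trans ((min_le_right _ _).trans (min_le_left _ _))
  have he3 : ε ≤ ε3 := hεle.trans ((min_le_right _ _).trans (min_le_right _ _))
  rw [hε3, le_div_iff₀ (by positivity)] at he3
  have ht0 : (0:ℝ) ≤ t 0 := by positivity
  have hK0 : (0:ℝ) ≤ K := by positivity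
  have hx1 : 0 ≤ ε * (t 0 * K) := by positivity
  have hx2 : 0 ≤ ε * t 0 := by positivity
  have hx3 : 0 ≤ ε * K := by positivity
  have hpow1 : 1 - δ1 ≤ (1 - ε)^(t 0) := by
    have h := one_add_mul_le_pow (a := -ε) (by nlinarith) (t 0)
    rw [← sub_eq_add_neg] at h
    nlinarith
  have hpow2 : 1 - δ1 ≤ (1 - K * ε)^(t 0) := by
    have h := one_add_mul_le_pow (a := -(K * ε)) (by nlinarith) (t 0)
    rw [← sub_eq_add_neg] at h
    nlinarith
  by_cases hm : ∃ i j, m i j = 0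
  · obtain ⟨i, j, hij⟩ := hm
    have : ∏ i, ∏ j, (m i j : ℝ) = 0 := by
      apply Finset.prod_eq_zero (Finset.mem_univ i)
      apply Finset.prod_eq_zero (Finset.mem_univ j)
      simp [hij]
    rw [this]
    simp
  push Not at hm
  have hseq := seq_lemma (B := ∀ i : Fin (d+1), Fin (t i.succ))
    (X := fun β' => ∀ i : Fin (d+1), Fin (m i.succ (β' i)))
    (fun β' Q a => PatGE ε (d+1) (fun i => m i.succ (β' i)) Q a) ε hε (by nlinarith)
    (by rw [← hK]; nlinarith) (t 0) (m 0)
    (fun j β' x α => P (Fin.cons j β')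
      (Fin.cons (α := fun i => Fin (m i ((Fin.cons j β' : ∀ i, Fin (t i)) i))) x α))
    (fun j β' => r (Fin.cons j β')) (fun _ _ => (hr0 _).le) (fun _ _ => hr1 _)
    (by
      intro j β' Q a hQ ha
      exact step_pattern ε (r (Fin.cons j β')) hε (by nlinarith) (hr0 _).le d _ _
        (hP (Fin.cons j β')) Q a hQ ha)
    (fun _ _ => true) (fun _ => 1)
    (fun β' => ones_pattern ε hε d _ (fun i => Nat.pos_of_ne_zero (hm _ _)))
    (fun _ => zero_le_one)
    (by
      intro β'
      rw [one_mul, Finset.prod_mul_distrib, Finset.prod_const, Finset.card_univ, Fintype.card_fin]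
      exact (he2.trans (H2 β')).trans (mul_le_mul_of_nonneg_left hpow1
        (Finset.prod_nonneg (fun _ _ => (hr0 _).le))))
  rw [← hK] at hseq
  obtain ⟨G, hG, hGc⟩ : ∃ G : Set (∀ j, Fin (m 0 j)),
      (∀ x ∈ G, ∀ b : (∀ i : Fin (d+1), Fin (t i.succ)),
        PatGE ε (d + 1) (fun i => m i.succ (b i))
          (fun α => true && decide (∀ (j : Fin (t 0)), P (Fin.cons j b)
            (Fin.cons (α := fun i => Fin (m i ((Fin.cons j b : ∀ i, Fin (t i)) i))) (x j) α)
              = true))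
          (1 * ∏ k, (r (Fin.cons k b) * (1 - ε)))) ∧
      (1 - K * ε)^(t 0) * ∏ j, (m 0 j : ℝ) ≤ (G.ncard : ℝ) := by
    refine ⟨_, ?_, hseq⟩
    intro x hx
    exact hx
  have hcons := ncard_cons_ge (fun i => (j : Fin (t i)) → Fin (m i j))
    {x | ∀ β, P β (fun i => x i (β i)) = true} G
    ((1 - δ1) * (∏ i : Fin (d+1), ∏ j, (m i.succ j : ℝ)) * (∏ β', r' β')) (by
      intro x0 hx0
      refine (H ε hε he1 (fun i => m i.succ) _ (fun β' => (hG x0 hx0 β').mono ?_)).trans ?_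
      · rw [one_mul, Finset.prod_mul_distrib, Finset.prod_const, Finset.card_univ,
          Fintype.card_fin]
        exact mul_le_mul_of_nonneg_left hpow1 (Finset.prod_nonneg (fun _ _ => (hr0 _).le))
      · norm_cast
        apply Set.ncard_le_ncard _ (Set.toFinite _)
        intro y hy β
        have h1 := hy (fun i => β i.succ)
        simp only [Bool.true_and, decide_eq_true_eq] at h1
        have h2 := h1 (β 0)
        obtain ⟨j, β', rfl⟩ : ∃ j β', β = Fin.cons j β' :=
          ⟨β 0, fun i => β i.succ, (Fin.cons_self_tail β).symm⟩
        refine (congrArg (P _) ?_).trans h2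
        funext i
        refine Fin.cases ?_ (fun k => ?_) i
        · rfl
        · rfl)
  refine le_trans ?_ hcons
  have hrpp : ∏ β', r' β' = (∏ β, r β) * (1 - δ1)^K := by
    simp only [r']
    rw [Finset.prod_mul_distrib, Finset.prod_const, Finset.card_univ, ← hK, prod_cons_eq t r]
  have hm0 : 0 ≤ ∏ j, (m 0 j : ℝ) := by positivity
  have hm1 : 0 ≤ ∏ i : Fin (d+1), ∏ j, (m i.succ j : ℝ) := by positivity
  have hrr : 0 ≤ ∏ β, r β := Finset.prod_nonneg (fun β _ => (hr0 β).le)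
  have hd1 : 0 ≤ 1 - δ1 := by linarith
  have hc0 : 0 ≤ (1 - δ1) * (∏ i : Fin (d+1), ∏ j, (m i.succ j : ℝ)) * (∏ β', r' β') := by
    rw [hrpp]; positivity
  refine le_trans ?_ (mul_le_mul_of_nonneg_right
    ((mul_le_mul_of_nonneg_right hpow2 hm0).trans hGc) hc0)
  rw [hrpp, Fin.prod_univ_succ]
  have := mul_le_mul_of_nonneg_right hδ1d (mul_nonneg (mul_nonneg hm0 hm1) hrr)
  refine le_trans (le_of_eq ?_) (this.trans (le_of_eq ?_)) <;> ring

theorem countS_all (d : ℕ) : CountS (d+1) := by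
  induction d with
  | zero => exact countS_one
  | succ d ih => exact countS_succ d ih

/-- **Counting lemma for multidimensional matrices.**  For any `δ > 0`, integers
`d ≥ 2` and `t i ≥ 1`, finite alphabet `T`, matrix `C` of sizes `t 1 × … × t d` over
`T` and reals `ρ β ∈ (0,1]`, there is `ε > 0` such that the following holds.  Let `A`
be a `d`-dimensional matrix over `T` whose index set of direction `i` is partitioned
into the sets `S^i_j = {⟨j, x⟩ : x ∈ Fin (m i j)}` of sizes `m i j` (the `i`-th index
ranging over the sigma type `Σ j, Fin (m i j)`), with blocks
`B β = S^1_{β 1} × … × S^d_{β d}`.  Suppose every block `B β` is an `ε`-regular pattern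
for some density vector `ρv` whose density `ρv (C β)` of the symbol `C β` equals `ρ β`.
Then the number of tuples `(x i j)` of indices with `x i j ∈ S^i_j` and
`A (x 1 (β 1), …, x d (β d)) = C β` for all `β` is at least
`(1 − δ)·∏_{i,j} m i j·∏_β ρ β`. -/
theorem counting_lemma_multidimensional (δ : ℝ) (hδ : 0 < δ)
    (d : ℕ) (hd : 2 ≤ d) (t : Fin d → ℕ) (ht : ∀ i, 1 ≤ t i)
    (T : Type) [Fintype T] [DecidableEq T]
    (C : (∀ i, Fin (t i)) → T) (ρ : (∀ i, Fin (t i)) → ℝ)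
    (hρ0 : ∀ β, 0 < ρ β) (hρ1 : ∀ β, ρ β ≤ 1) :
    ∃ ε : ℝ, 0 < ε ∧
      ∀ (m : ∀ i, Fin (t i) → ℕ) (A : (∀ i, (j : Fin (t i)) × Fin (m i j)) → T),
        (∀ β : ∀ i, Fin (t i), ∃ ρv : T → ℝ,
            IsRegPattern ε d (fun i => m i (β i))
              (fun x => some (A fun i => ⟨β i, x i⟩)) ρv ∧
            ρv (C β) = ρ β) →
        (1 - δ) * (∏ i, ∏ j, (m i j : ℝ)) * (∏ β : ∀ i, Fin (t i), ρ β) ≤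
          ((Finset.univ.filter fun x : ∀ i, (j : Fin (t i)) → Fin (m i j) =>
              ∀ β : ∀ i, Fin (t i), A (fun i => ⟨β i, x i (β i)⟩) = C β).card : ℝ) := by
  obtain ⟨d, rfl⟩ : ∃ k, d = k + 1 := ⟨d - 1, by omega⟩
  obtain ⟨ε, hε, H⟩ := countS_all d t ρ hρ0 hρ1 δ hδ
  refine ⟨ε, hε, ?_⟩
  intro m A hA
  have h := H ε hε le_rfl m (fun β x => decide (A (fun i => ⟨β i, x i⟩) = C β)) (by
    intro β
    obtain ⟨ρv, h1, h2⟩ := hA β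
    obtain ⟨ρ', ha, _, hc⟩ := indicator_pattern ε (C β) d _ _ ρv
      (fun x => some (decide (A (fun i => ⟨β i, x i⟩) = C β))) (by intro α; simp) h1
    exact ⟨ρ', by rw [ha, h2], hc⟩)
  refine h.trans (le_of_eq ?_)
  congr 1
  rw [Set.ncard_eq_toFinset_card']
  congr 1
  ext x
  simp
end
end
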